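/- arXiv:2303.10060 — 15 statements merged into one kernel-verified Lean document; each statement's English description precedes it below -/
import Mathlib

section
/- Let H be a complex Hilbert space and let (ξ_n)_{n∈ℕ} be a frame for H with bounds A, B > 0. Let (φ_n)_{n∈ℕ} be a sequence in H and suppose there exists B' with 0 ≤ B' < A such that ∑_{n=0}^∞ |⟨f, ξ_n − φ_n⟩|² ≤ B'‖f‖² for all f ∈ H. Then (φ_n) is a frame for H with bounds A(1 − √(B'/A))² and B(1 + √(B'/B))². Moreover, if (ξ_n) is a Riesz basis for H, then (φ_n) is also a Riesz basis for H. -/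
open scoped ComplexInnerProductSpace
open Filter Topology

/-- `ξ` is a frame for `H` with bounds `A`, `B`:
`A‖f‖² ≤ ∑ₙ |⟨ξ n, f⟩|² ≤ B‖f‖²` for every `f ∈ H`. -/
def IsFrame {H : Type*} [NormedAddCommGroup H] [InnerProductSpace ℂ H]
    (ξ : ℕ → H) (A B : ℝ) : Prop :=
  0 < A ∧ 0 < B ∧ ∀ f : H,
    Summable (fun n => ‖⟪ξ n, f⟫‖ ^ 2) ∧
    A * ‖f‖ ^ 2 ≤ ∑' n, ‖⟪ξ n, f⟫‖ ^ 2 ∧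
    (∑' n, ‖⟪ξ n, f⟫‖ ^ 2) ≤ B * ‖f‖ ^ 2

/-- `ξ` is a Riesz basis for `H`: `ξ n = T (e n)` for an orthonormal basis `e`
and a bounded bijective operator `T`. -/
def IsRieszBasis {H : Type*} [NormedAddCommGroup H] [InnerProductSpace ℂ H] [CompleteSpace H]
    (ξ : ℕ → H) : Prop :=
  ∃ (e : HilbertBasis ℕ ℂ H) (T : H →L[ℂ] H),
    Function.Bijective T ∧ ∀ n, ξ n = T (e n)

namespace RieszFrame

/-- The square of the norm on `ℓ²` is the sum of the squares of the coordinates. -/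
theorem lp_two_hasSum_norm_sq (g : lp (fun _ : ℕ => ℂ) 2) :
    HasSum (fun n => ‖g n‖ ^ 2) (‖g‖ ^ 2) := by
  simpa using lp.hasSum_norm (p := 2) (by norm_num) g

/-- A Bessel sequence has a bounded analysis operator into `ℓ²`. -/
theorem exists_analysis {H : Type*} [NormedAddCommGroup H] [InnerProductSpace ℂ H]
    (η : ℕ → H) (C : ℝ) (hs : ∀ f : H, Summable (fun n => ‖⟪η n, f⟫‖ ^ 2))
    (hC : ∀ f : H, ∑' n, ‖⟪η n, f⟫‖ ^ 2 ≤ C * ‖f‖ ^ 2) :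
    ∃ V : H →L[ℂ] lp (fun _ : ℕ => ℂ) 2, ∀ f n, V f n = ⟪η n, f⟫ := by
  have hmem (f : H) : Memℓp (fun n => ⟪η n, f⟫) 2 := by
    rw [memℓp_gen_iff (by norm_num)]
    simpa using hs f
  let L : H →ₗ[ℂ] lp (fun _ : ℕ => ℂ) 2 :=
    { toFun := fun f => ⟨fun n => ⟪η n, f⟫, hmem f⟩
      map_add' := fun f g => by
        ext n
        exact inner_add_right _ _ _
      map_smul' := fun c f => by
        ext n
        exact inner_smul_right _ _ _ }
  refine ⟨L.mkContinuous (√C) fun f => ?_, fun f n => rfl⟩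
  have hL : ‖L f‖ ^ 2 ≤ C * ‖f‖ ^ 2 := (lp_two_hasSum_norm_sq (L f)).tsum_eq ▸ hC f
  simpa [Real.sqrt_mul', Real.sqrt_sq] using Real.le_sqrt_of_sq_le hL

/-- If `T` is invertible with `T†` bounded below by `a`, and `‖R†f‖ ≤ b‖f‖` with `b < a`,
then `T - R` is bijective. -/
theorem bijective_sub_of_adjoint_bounds {H : Type*} [NormedAddCommGroup H]
    [InnerProductSpace ℂ H] [CompleteSpace H] (T R : H →L[ℂ] H) {a b : ℝ}
    (hT : Function.Bijective T) (hb : 0 ≤ b) (hab : b < a)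
    (hTa : ∀ f, a * ‖f‖ ≤ ‖star T f‖) (hRb : ∀ f, ‖star R f‖ ≤ b * ‖f‖) :
    Function.Bijective (T - R) := by
  have ha : 0 < a := hb.trans_lt hab
  obtain ⟨u, hu⟩ := (ContinuousLinearMap.isUnit_iff_bijective.2 hT).star
  have hinv (g : H) : star T ((↑u⁻¹ : H →L[ℂ] H) g) = g := by
    rw [← hu]
    exact congrArg (fun S : H →L[ℂ] H => S g) u.mul_inv
  have hnorm : ‖star R * (↑u⁻¹ : H →L[ℂ] H)‖ < 1 := by
    refine lt_of_le_of_lt (ContinuousLinearMap.opNorm_le_bound _ (div_nonneg hb ha.le)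
      fun g => ?_) ((div_lt_one ha).2 hab)
    have h1 := hTa ((↑u⁻¹ : H →L[ℂ] H) g)
    rw [hinv, mul_comm, ← le_div_iff₀ ha] at h1
    calc ‖star R ((↑u⁻¹ : H →L[ℂ] H) g)‖ ≤ b * ‖(↑u⁻¹ : H →L[ℂ] H) g‖ := hRb _
      _ ≤ b * (‖g‖ / a) := by gcongr
      _ = b / a * ‖g‖ := by ring
  have hunit : IsUnit (star (T - R)) := by
    have h : star (T - R) = (1 - star R * (↑u⁻¹ : H →L[ℂ] H)) * u := by
      rw [sub_mul, mul_assoc, u.inv_mul, one_mul, mul_one, hu, star_sub]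
    rw [h]
    exact (isUnit_one_sub_of_norm_lt_one hnorm).mul u.isUnit
  exact ContinuousLinearMap.isUnit_iff_bijective.1 (isUnit_star.1 hunit)

end RieszFrame

theorem stmt0 {H : Type*} [NormedAddCommGroup H] [InnerProductSpace ℂ H] [CompleteSpace H]
    (ξ φ : ℕ → H) (A B B' : ℝ)
    (hframe : IsFrame ξ A B)
    (hB'0 : 0 ≤ B') (hB'A : B' < A)
    (hpert : ∀ f : H, Summable (fun n => ‖⟪f, ξ n - φ n⟫‖ ^ 2) ∧
      (∑' n, ‖⟪f, ξ n - φ n⟫‖ ^ 2) ≤ B' * ‖f‖ ^ 2) :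
    IsFrame φ (A * (1 - Real.sqrt (B' / A)) ^ 2) (B * (1 + Real.sqrt (B' / B)) ^ 2) ∧
      (IsRieszBasis ξ → IsRieszBasis φ) := by
  obtain ⟨hA, hB, hf⟩ := hframe
  have hpert' (f : H) : (fun n => ‖⟪f, ξ n - φ n⟫‖ ^ 2) = fun n => ‖⟪ξ n - φ n, f⟫‖ ^ 2 :=
    funext fun n => by rw [norm_inner_symm]
  simp only [hpert'] at hpert
  obtain ⟨U, hU⟩ := RieszFrame.exists_analysis ξ B (fun f => (hf f).1) fun f => (hf f).2.2
  obtain ⟨V, hV⟩ := RieszFrame.exists_analysis (fun n => ξ n - φ n) B'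
    (fun f => (hpert f).1) fun f => (hpert f).2
  have hUsum (f : H) : ∑' n, ‖⟪ξ n, f⟫‖ ^ 2 = ‖U f‖ ^ 2 := by
    simpa only [hU] using (RieszFrame.lp_two_hasSum_norm_sq (U f)).tsum_eq
  have hVsum (f : H) : ∑' n, ‖⟪ξ n - φ n, f⟫‖ ^ 2 = ‖V f‖ ^ 2 := by
    simpa only [hV] using (RieszFrame.lp_two_hasSum_norm_sq (V f)).tsum_eq
  have hφsum (f : H) : HasSum (fun n => ‖⟪φ n, f⟫‖ ^ 2) (‖U f - V f‖ ^ 2) := by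
    have h (n : ℕ) : (U f - V f) n = ⟪φ n, f⟫ := by
      rw [lp.coeFn_sub, Pi.sub_apply, hU, hV, inner_sub_left, sub_sub_cancel]
    simpa only [h] using RieszFrame.lp_two_hasSum_norm_sq (U f - V f)
  have hUlow (f : H) : √A * ‖f‖ ≤ ‖U f‖ := by
    refine le_of_sq_le_sq ?_ (norm_nonneg _)
    rw [mul_pow, Real.sq_sqrt hA.le, ← hUsum]
    exact (hf f).2.1
  have hUup (f : H) : ‖U f‖ ≤ √B * ‖f‖ := by
    refine le_of_sq_le_sq ?_ (by positivity)
    rw [mul_pow, Real.sq_sqrt hB.le, ← hUsum]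
    exact (hf f).2.2
  have hVup (f : H) : ‖V f‖ ≤ √B' * ‖f‖ := by
    refine le_of_sq_le_sq ?_ (by positivity)
    rw [mul_pow, Real.sq_sqrt hB'0, ← hVsum]
    exact (hpert f).2
  have hlt : √B' < √A := Real.sqrt_lt_sqrt hB'0 hB'A
  have hAeq : A * (1 - √(B' / A)) ^ 2 = (√A - √B') ^ 2 := by
    have := Real.sqrt_pos.2 hA
    rw [Real.sqrt_div hB'0]
    nth_rw 1 [← Real.sq_sqrt hA.le]
    field_simp
  have hBeq : B * (1 + √(B' / B)) ^ 2 = (√B + √B') ^ 2 := by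
    have := Real.sqrt_pos.2 hB
    rw [Real.sqrt_div hB'0]
    nth_rw 1 [← Real.sq_sqrt hB.le]
    field_simp
  refine ⟨⟨?_, by positivity, fun f => ⟨(hφsum f).summable, ?_, ?_⟩⟩, ?_⟩
  · rw [hAeq]
    exact pow_pos (sub_pos.2 hlt) 2
  · rw [(hφsum f).tsum_eq, hAeq, ← mul_pow]
    refine pow_le_pow_left₀ (mul_nonneg (sub_pos.2 hlt).le (norm_nonneg f)) ?_ 2
    linarith [hUlow f, hVup f, norm_sub_norm_le (U f) (V f)]
  · rw [(hφsum f).tsum_eq, hBeq, ← mul_pow]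
    refine pow_le_pow_left₀ (norm_nonneg _) ?_ 2
    linarith [hUup f, hVup f, norm_sub_le (U f) (V f)]
  · rintro ⟨e, T, hT, hξ⟩
    have hUT (f : H) : U f = e.repr (star T f) := by
      ext n
      rw [hU, hξ, e.repr_apply_apply, ContinuousLinearMap.star_eq_adjoint,
        ContinuousLinearMap.adjoint_inner_right]
    let R : H →L[ℂ] H := star ((e.repr.symm : _ →L[ℂ] H) ∘L V)
    have hR (f : H) : star R f = e.repr.symm (V f) := by
      simp only [R, star_star]
      rfl
    have hRe (n : ℕ) : R (e n) = ξ n - φ n := by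
      refine ext_inner_right ℂ fun f => ?_
      rw [← ContinuousLinearMap.adjoint_inner_right, ← ContinuousLinearMap.star_eq_adjoint, hR,
        ← e.repr_apply_apply, LinearIsometryEquiv.apply_symm_apply, hV]
    refine ⟨e, T - R, RieszFrame.bijective_sub_of_adjoint_bounds T R hT (Real.sqrt_nonneg B') hlt
      (fun f => ?_) (fun f => ?_), fun n => ?_⟩
    · rw [← e.repr.norm_map (star T f), ← hUT]
      exact hUlow f
    · rw [hR, LinearIsometryEquiv.norm_map]
      exact hVup f
    · rw [sub_apply, hRe, ← hξ, sub_sub_cancel]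
end

section
/- Let H be a complex Hilbert space, let (ξ_n)_{n∈ℕ} be a Schauder basis for H, and let (φ_n)_{n∈ℕ} be a sequence in H. Suppose there exists α with 0 ≤ α < 1 such that ‖∑_n c_n (ξ_n − φ_n)‖ ≤ α ‖∑_n c_n ξ_n‖ for every finitely supported complex sequence (c_n). Then (φ_n) is a Schauder basis for H. -/
open scoped ComplexInnerProductSpace
open Filter Topology

/-- `ξ` is a Schauder basis for `H`: every `f ∈ H` has a unique expansion
`f = ∑ₙ c n • ξ n` (convergence of the partial sums in norm). -/
def IsSchauderBasis {H : Type*} [NormedAddCommGroup H] [InnerProductSpace ℂ H]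
    (ξ : ℕ → H) : Prop :=
  ∀ f : H, ∃! c : ℕ → ℂ,
    Tendsto (fun N => ∑ n ∈ Finset.range N, c n • ξ n) atTop (𝓝 f)

theorem IsSchauderBasis.map {H : Type*} [NormedAddCommGroup H] [InnerProductSpace ℂ H]
    {ξ : ℕ → H} (hξ : IsSchauderBasis ξ) (S : H ≃L[ℂ] H) :
    IsSchauderBasis (fun n => S (ξ n)) := by
  have key (f : H) (c : ℕ → ℂ) :
      Tendsto (fun N => ∑ n ∈ Finset.range N, c n • S (ξ n)) atTop (𝓝 f) ↔
        Tendsto (fun N => ∑ n ∈ Finset.range N, c n • ξ n) atTop (𝓝 (S.symm f)) := by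
    rw [S.symm.toHomeomorph.isInducing.tendsto_nhds_iff]
    simp [Function.comp_def]
  intro f
  simpa only [key] using hξ (S.symm f)

theorem IsSchauderBasis.denseRange_linearCombination {H : Type*} [NormedAddCommGroup H]
    [InnerProductSpace ℂ H] {ξ : ℕ → H} (hξ : IsSchauderBasis ξ) :
    DenseRange (Finsupp.linearCombination ℂ ξ) := by
  intro f
  obtain ⟨c, hc, -⟩ := hξ f
  refine mem_closure_of_tendsto hc (Eventually.of_forall fun N => ?_)
  exact ⟨∑ n ∈ Finset.range N, Finsupp.single n (c n), by simp⟩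

theorem stmt1 {H : Type*} [NormedAddCommGroup H] [InnerProductSpace ℂ H] [CompleteSpace H]
    (ξ φ : ℕ → H) (α : ℝ) (hα0 : 0 ≤ α) (hα1 : α < 1)
    (hbasis : IsSchauderBasis ξ)
    (hpert : ∀ c : ℕ →₀ ℂ,
      ‖∑ n ∈ c.support, c n • (ξ n - φ n)‖ ≤ α * ‖∑ n ∈ c.support, c n • ξ n‖) :
    IsSchauderBasis φ := by
  have hdense := hbasis.denseRange_linearCombination
  have hnorm (c : ℕ →₀ ℂ) : ‖Finsupp.linearCombination ℂ (fun n => ξ n - φ n) c‖ ≤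
      α * ‖Finsupp.linearCombination ℂ ξ c‖ := hpert c
  let T : H →L[ℂ] H := (Finsupp.linearCombination ℂ (fun n => ξ n - φ n)).extendOfNorm
    (Finsupp.linearCombination ℂ ξ)
  have hT : ‖T‖ < 1 := (LinearMap.opNorm_extendOfNorm_le hdense hα0 hnorm).trans_lt hα1
  have hTξ (n : ℕ) : T (ξ n) = ξ n - φ n := by
    simpa using LinearMap.extendOfNorm_eq hdense ⟨α, hnorm⟩ (Finsupp.single n 1)
  have hφ : φ = fun n => ContinuousLinearEquiv.unitsEquiv ℂ H (Units.oneSub T hT) (ξ n) := by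
    funext n
    simp [hTξ]
  rw [hφ]
  exact hbasis.map _
end

section
/- Let H be a complex Hilbert space, let (ξ_n)_{n∈ℕ} be a frame for H with bounds A, B > 0, and let (φ_n)_{n∈ℕ} be a sequence in H. Suppose there exists α with 0 ≤ α < 1 such that ‖∑_n c_n (ξ_n − φ_n)‖ ≤ α ‖∑_n c_n ξ_n‖ for every finitely supported complex sequence (c_n). Then (φ_n) is a frame for H with bounds A(1 − α)² and B(1 + α)². -/
open scoped ComplexInnerProductSpace
open Filter Topology

namespace IsFrame

variable {H : Type*} [NormedAddCommGroup H] [InnerProductSpace ℂ H] [CompleteSpace H]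
  {ξ : ℕ → H} {A B : ℝ}

/-- Finite linear combinations of the elements of a frame are dense. -/
theorem denseRange_linearCombination (h : IsFrame ξ A B) :
    DenseRange (Finsupp.linearCombination ℂ ξ) := by
  have hspan : (Submodule.span ℂ (Set.range ξ)).topologicalClosure = ⊤ := by
    rw [Submodule.topologicalClosure_eq_top_iff, Submodule.eq_bot_iff]
    intro f hf
    have hzero (n : ℕ) : ⟪ξ n, f⟫ = 0 :=
      hf (ξ n) (Submodule.subset_span (Set.mem_range_self n))
    have hle := (h.2.2 f).2.1
    simp only [hzero, norm_zero, ne_eq, OfNat.ofNat_ne_zero, not_false_eq_true, zero_pow,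
      tsum_zero] at hle
    have : ‖f‖ ^ 2 ≤ 0 := nonpos_of_mul_nonpos_right hle h.1
    exact norm_eq_zero.mp (pow_eq_zero_iff two_ne_zero |>.mp (le_antisymm this (sq_nonneg _)))
  rw [← Submodule.dense_iff_topologicalClosure_eq_top, ← Finsupp.range_linearCombination] at hspan
  rwa [LinearMap.coe_range] at hspan

/-- The image of a frame under an operator whose adjoint is bounded above and below. -/
theorem map_of_norm_adjoint_bounds (h : IsFrame ξ A B) (T : H →L[ℂ] H) {m M : ℝ}
    (hm : 0 < m) (hM : 0 < M) (hlower : ∀ f, m * ‖f‖ ≤ ‖T.adjoint f‖)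
    (hupper : ∀ f, ‖T.adjoint f‖ ≤ M * ‖f‖) :
    IsFrame (fun n => T (ξ n)) (A * m ^ 2) (B * M ^ 2) := by
  obtain ⟨hA, hB, hf⟩ := h
  refine ⟨by positivity, by positivity, fun f => ?_⟩
  simp only [← ContinuousLinearMap.adjoint_inner_right]
  obtain ⟨hsum, hlow, hup⟩ := hf (T.adjoint f)
  refine ⟨hsum, le_trans ?_ hlow, hup.trans ?_⟩
  · rw [mul_assoc, ← mul_pow]
    gcongr
    exact hlower f
  · rw [mul_assoc, ← mul_pow]
    gcongr
    exact hupper f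

end IsFrame

theorem stmt2 {H : Type*} [NormedAddCommGroup H] [InnerProductSpace ℂ H] [CompleteSpace H]
    (ξ φ : ℕ → H) (A B : ℝ) (hframe : IsFrame ξ A B)
    (α : ℝ) (hα0 : 0 ≤ α) (hα1 : α < 1)
    (hpert : ∀ c : ℕ →₀ ℂ,
      ‖∑ n ∈ c.support, c n • (ξ n - φ n)‖ ≤ α * ‖∑ n ∈ c.support, c n • ξ n‖) :
    IsFrame φ (A * (1 - α) ^ 2) (B * (1 + α) ^ 2) := by
  let e := Finsupp.linearCombination ℂ ξ
  let g := Finsupp.linearCombination ℂ (fun n => ξ n - φ n)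
  have hdense : DenseRange e := hframe.denseRange_linearCombination
  have hbound (c : ℕ →₀ ℂ) : ‖g c‖ ≤ α * ‖e c‖ := by
    simpa [e, g, Finsupp.linearCombination_apply, Finsupp.sum] using hpert c
  let D : H →L[ℂ] H := g.extendOfNorm e
  have hD (n : ℕ) : D (ξ n) = ξ n - φ n := by
    simpa [e, g] using LinearMap.extendOfNorm_eq hdense ⟨α, hbound⟩ (Finsupp.single n 1)
  have hDnorm : ‖D‖ ≤ α := LinearMap.opNorm_extendOfNorm_le hdense hα0 hbound
  let T : H →L[ℂ] H := ContinuousLinearMap.id ℂ H - D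
  have hT : φ = fun n => T (ξ n) := by
    ext n
    simp [T, hD]
  have hDadj (f : H) : ‖D.adjoint f‖ ≤ α * ‖f‖ :=
    D.adjoint.le_of_opNorm_le (by rwa [LinearIsometryEquiv.norm_map]) f
  have hTadj (f : H) : T.adjoint f = f - D.adjoint f := by
    refine ext_inner_right ℂ fun v => ?_
    simp [T, ContinuousLinearMap.adjoint_inner_left, inner_sub_left]
  rw [hT]
  refine hframe.map_of_norm_adjoint_bounds T (by linarith) (by linarith)
    (fun f => ?_) (fun f => ?_)
  · rw [hTadj]
    linarith [norm_sub_norm_le f (D.adjoint f), hDadj f]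
  · rw [hTadj]
    linarith [norm_sub_le f (D.adjoint f), hDadj f]
end

section
/- Let H be a complex Hilbert space, let (ξ_n)_{n∈ℕ} be a Riesz basis for H, and let (φ_n)_{n∈ℕ} be a sequence in H. Suppose there exists α with 0 ≤ α < 1 such that ‖∑_n c_n (ξ_n − φ_n)‖ ≤ α ‖∑_n c_n ξ_n‖ for every finitely supported complex sequence (c_n). Then (φ_n) is a Riesz basis for H. -/
open scoped ComplexInnerProductSpace
open Filter Topology

theorem IsRieszBasis.dense_span {H : Type*} [NormedAddCommGroup H] [InnerProductSpace ℂ H]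
    [CompleteSpace H] {ξ : ℕ → H} (h : IsRieszBasis ξ) :
    Dense (Submodule.span ℂ (Set.range ξ) : Set H) := by
  obtain ⟨e, T, hT, hξ⟩ := h
  obtain rfl : ξ = T ∘ e := funext hξ
  have he : Dense (Submodule.span ℂ (Set.range e) : Set H) :=
    Submodule.dense_iff_topologicalClosure_eq_top.2 e.dense_span
  have := hT.surjective.denseRange.dense_image T.continuous he
  rw [Set.range_comp]
  convert this using 1
  exact congrArg _ (Submodule.map_span (T : H →ₗ[ℂ] H) (Set.range e)).symm

theorem stmt3 {H : Type*} [NormedAddCommGroup H] [InnerProductSpace ℂ H] [CompleteSpace H]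
    (ξ φ : ℕ → H) (hriesz : IsRieszBasis ξ)
    (α : ℝ) (hα0 : 0 ≤ α) (hα1 : α < 1)
    (hpert : ∀ c : ℕ →₀ ℂ,
      ‖∑ n ∈ c.support, c n • (ξ n - φ n)‖ ≤ α * ‖∑ n ∈ c.support, c n • ξ n‖) :
    IsRieszBasis φ := by
  set e : (ℕ →₀ ℂ) →ₗ[ℂ] H := Finsupp.linearCombination ℂ ξ
  set f : (ℕ →₀ ℂ) →ₗ[ℂ] H := Finsupp.linearCombination ℂ (ξ - φ)
  have hdense : DenseRange e := by
    have := hriesz.dense_span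
    rwa [← Finsupp.range_linearCombination, LinearMap.coe_range] at this
  have hnorm : ∀ c, ‖f c‖ ≤ α * ‖e c‖ := hpert
  have hlt : ‖f.extendOfNorm e‖ < 1 :=
    (LinearMap.opNorm_extendOfNorm_le hdense hα0 hnorm).trans_lt hα1
  have hdiff : ∀ n, f.extendOfNorm e (ξ n) = ξ n - φ n := fun n => by
    simpa [e, f] using
      LinearMap.extendOfNorm_eq hdense ⟨α, hnorm⟩ (Finsupp.single n (1 : ℂ))
  have hbij : Function.Bijective (1 - f.extendOfNorm e : H →L[ℂ] H) :=
    ContinuousLinearMap.isUnit_iff_bijective.1 (isUnit_one_sub_of_norm_lt_one hlt)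
  obtain ⟨b, T, hT, hξ⟩ := hriesz
  refine ⟨b, (1 - f.extendOfNorm e) ∘L T, ?_, fun n => ?_⟩
  · rw [ContinuousLinearMap.coe_comp]
    exact hbij.comp hT
  · simp [← hξ, hdiff]
end

section
/- Let H be a complex Hilbert space, let D be a dense linear subspace of H, and let (φ_n)_{n∈ℕ} and (ψ_n)_{n∈ℕ} be sequences in H such that for every f ∈ D the series ∑_{n=0}^∞ ⟨φ_n, f⟩ ψ_n converges in H. Suppose there exist α with 0 ≤ α < 1 and a nonzero complex number λ such that ‖λ ∑_{n=0}^∞ ⟨φ_n, f⟩ ψ_n − f‖ ≤ α‖f‖ for all f ∈ D. Then there exists a sequence (φ̃_n)_{n∈ℕ} in H such that f = ∑_{n=0}^∞ ⟨φ_n, f⟩ φ̃_n (convergence in norm) for every f ∈ D. -/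
open scoped ComplexInnerProductSpace
open Filter Topology

/-- A linear map on a dense subspace whose difference from the inclusion is a strict contraction has a
bounded left inverse. -/
theorem LinearMap.exists_leftInverse_of_norm_sub_le {𝕜 H : Type*} [NontriviallyNormedField 𝕜]
    [NormedAddCommGroup H] [NormedSpace 𝕜 H] [CompleteSpace H]
    {D : Submodule 𝕜 H} (hD : Dense (D : Set H)) (S : D →ₗ[𝕜] H) {α : ℝ} (hα0 : 0 ≤ α)
    (hα1 : α < 1) (hS : ∀ f : D, ‖S f - f‖ ≤ α * ‖f‖) :
    ∃ B : H →L[𝕜] H, ∀ f : D, B (S f) = f := by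
  have hdense : DenseRange D.subtype := by simpa [DenseRange] using hD
  have hbound : ∀ f : D, ‖(D.subtype - S) f‖ ≤ α * ‖D.subtype f‖ := fun f => by
    simpa [norm_sub_rev] using hS f
  set T : H →L[𝕜] H := (D.subtype - S).extendOfNorm D.subtype with hT
  have hTnorm : ‖T‖ < 1 := (LinearMap.opNorm_extendOfNorm_le hdense hα0 hbound).trans_lt hα1
  obtain ⟨u, hu⟩ := isUnit_one_sub_of_norm_lt_one hTnorm
  refine ⟨↑u⁻¹, fun f => ?_⟩
  have hTf : T f = f - S f := LinearMap.extendOfNorm_eq hdense ⟨α, hbound⟩ f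
  have hSf : S f = (u : H →L[𝕜] H) f := by simp [hu, hTf]
  rw [hSf, ← mul_apply_eq_comp, Units.inv_mul, one_apply_eq_self]

theorem stmt4 {H : Type*} [NormedAddCommGroup H] [InnerProductSpace ℂ H] [CompleteSpace H]
    (D : Submodule ℂ H) (hD : Dense (D : Set H))
    (φ ψ : ℕ → H) (α : ℝ) (hα0 : 0 ≤ α) (hα1 : α < 1) (lam : ℂ) (hlam : lam ≠ 0)
    (h : ∀ f ∈ D, ∃ s : H,
      Tendsto (fun N => ∑ n ∈ Finset.range N, ⟪φ n, f⟫ • ψ n) atTop (𝓝 s) ∧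
      ‖lam • s - f‖ ≤ α * ‖f‖) :
    ∃ φt : ℕ → H, ∀ f ∈ D,
      Tendsto (fun N => ∑ n ∈ Finset.range N, ⟪φ n, f⟫ • φt n) atTop (𝓝 f) := by
  choose! s hs hbound using h
  let S : D →ₗ[ℂ] H :=
    { toFun := fun f => s f
      map_add' := fun f g => tendsto_nhds_unique (hs _ (f + g).2) <| by
        simpa [inner_add_right, add_smul, Finset.sum_add_distrib]
          using (hs f f.2).add (hs g g.2)
      map_smul' := fun c f => tendsto_nhds_unique (hs _ (c • f).2) <| by
        simpa [inner_smul_right, mul_smul, Finset.smul_sum] using (hs f f.2).const_smul c }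
  obtain ⟨B, hB⟩ := LinearMap.exists_leftInverse_of_norm_sub_le hD (lam • S) hα0 hα1
    fun f => hbound f f.2
  refine ⟨fun n => lam • B (ψ n), fun f hf => ?_⟩
  have hBf : lam • B (s f) = f := by
    rw [← map_smul]
    exact hB ⟨f, hf⟩
  have hlim := ((B.continuous.tendsto _).comp (hs f hf)).const_smul lam
  rw [hBf] at hlim
  simpa [Function.comp_def, Finset.smul_sum, smul_comm lam] using hlim
end

section
/- Let H be a complex Hilbert space and let (φ_n)_{n∈ℕ} and (ψ_n)_{n∈ℕ} be sequences in H such that for every f ∈ H the series ∑_{n=0}^∞ ⟨φ_n, f⟩ ψ_n converges in H. Suppose there exist α with 0 ≤ α < 1 and a nonzero complex number λ such that ‖λ ∑_{n=0}^∞ ⟨φ_n, f⟩ ψ_n − f‖ ≤ α‖f‖ for all f ∈ H. Then there exist sequences (φ̃_n)_{n∈ℕ} and (ψ̃_n)_{n∈ℕ} in H such that f = ∑_{n=0}^∞ ⟨φ_n, f⟩ φ̃_n = ∑_{n=0}^∞ ⟨ψ̃_n, f⟩ ψ_n (convergence in norm) for every f ∈ H, and moreover ⟨φ_n, φ̃_m⟩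 = ⟨ψ̃_n, ψ_m⟩ for all n, m ∈ ℕ. -/
open scoped ComplexInnerProductSpace
open Filter Topology

theorem stmt5 {H : Type*} [NormedAddCommGroup H] [InnerProductSpace ℂ H] [CompleteSpace H]
    (φ ψ : ℕ → H) (α : ℝ) (hα0 : 0 ≤ α) (hα1 : α < 1) (lam : ℂ) (hlam : lam ≠ 0)
    (h : ∀ f : H, ∃ s : H,
      Tendsto (fun N => ∑ n ∈ Finset.range N, ⟪φ n, f⟫ • ψ n) atTop (𝓝 s) ∧
      ‖lam • s - f‖ ≤ α * ‖f‖) :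
    ∃ φt ψt : ℕ → H,
      (∀ f : H,
        Tendsto (fun N => ∑ n ∈ Finset.range N, ⟪φ n, f⟫ • φt n) atTop (𝓝 f) ∧
        Tendsto (fun N => ∑ n ∈ Finset.range N, ⟪ψt n, f⟫ • ψ n) atTop (𝓝 f)) ∧
      ∀ n m : ℕ, ⟪φ n, φt m⟫ = ⟪ψt n, ψ m⟫ := by
  choose s hs hbound using h
  let partialSum (N : ℕ) : H →L[ℂ] H :=
    ∑ n ∈ Finset.range N, (innerSL ℂ (φ n)).smulRight (ψ n)
  have partialSum_apply (N : ℕ) (f : H) :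
      partialSum N f = ∑ n ∈ Finset.range N, ⟪φ n, f⟫ • ψ n := by
    simp [partialSum]
  let S : H →L[ℂ] H := continuousLinearMapOfTendsto (l := atTop) (f := s) partialSum <| by
    simpa only [tendsto_pi_nhds, partialSum_apply] using hs
  have hS (f : H) : S f = s f := rfl
  have hnorm : ‖1 - lam • S‖ < 1 := by
    refine (ContinuousLinearMap.opNorm_le_bound _ hα0 fun f => ?_).trans_lt hα1
    simpa [hS, norm_sub_rev] using hbound f
  obtain ⟨u, hu⟩ : IsUnit (lam • S) := by
    simpa using isUnit_one_sub_of_norm_lt_one hnorm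
  let T : H →L[ℂ] H := lam • (↑u⁻¹ : H →L[ℂ] H)
  have hTS (f : H) : T (s f) = f := by
    have hmul : (↑u⁻¹ : H →L[ℂ] H) * (lam • S) = 1 := by rw [← hu, u.inv_mul]
    simpa [T, hS] using congr($hmul f)
  have hST (f : H) : s (T f) = f := by
    have hmul : (lam • S) * (↑u⁻¹ : H →L[ℂ] H) = 1 := by rw [← hu, u.mul_inv]
    rw [← hS]
    simpa [T] using congr($hmul f)
  refine ⟨fun n => T (ψ n), fun n => T.adjoint (φ n), fun f => ⟨?_, ?_⟩, fun n m => ?_⟩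
  · simpa [Function.comp_def, hTS] using (T.continuous.tendsto (s f)).comp (hs f)
  · simpa [ContinuousLinearMap.adjoint_inner_left, hST] using hs (T f)
  · exact (T.adjoint_inner_left _ _).symm
end

section
/- Let H be a complex Hilbert space, let D be a dense linear subspace of H, and let (ξ_n)_{n∈ℕ} and (χ_n)_{n∈ℕ} be sequences in H such that f = ∑_{n=0}^∞ ⟨ξ_n, f⟩ χ_n (convergence in norm) for all f ∈ D. Let (φ_n)_{n∈ℕ} and (ψ_n)_{n∈ℕ} be sequences in H, let β, γ ≥ 0 with β + γ < 1, and let λ be a nonzero complex number, such that for every f ∈ D the series ∑_{n=0}^∞ ⟨λφ_n − ξ_n, f⟩ ψ_n and ∑_{n=0}^∞ ⟨ξ_n, f⟩ (ψ_n − χ_n) converge in H with ‖∑_{n=0}^∞ ⟨λφ_n − ξ_n, f⟩ ψ_n‖ ≤ β‖f‖ and ‖∑_{n=0}^∞ ⟨ξ_n, f⟩ (ψ_n − χ_n)‖ ≤ γ‖f‖. Then there exists a sequence (φ̃_n)_{n∈ℕ} in H such that f = ∑_{n=0}^∞ ⟨φ_n, f⟩ φ̃_n for every f ∈ D. -/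
open scoped ComplexInnerProductSpace
open Filter Topology

/-- A perturbation of the identity by a relatively small linear map on a dense subspace has a
bounded left inverse. -/
theorem exists_clm_leftInverse_of_norm_sub_le {H : Type*} [NormedAddCommGroup H]
    [NormedSpace ℂ H] [CompleteSpace H] (D : Submodule ℂ H) (hD : Dense (D : Set H))
    (A : D →ₗ[ℂ] H) {c : ℝ} (hc0 : 0 ≤ c) (hc : c < 1)
    (hA : ∀ f : D, ‖A f - f‖ ≤ c * ‖f‖) :
    ∃ T : H →L[ℂ] H, ∀ f : D, T (A f) = f := by
  let K : D →L[ℂ] H := (D.subtype - A).mkContinuous c fun f => by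
    simpa [norm_sub_rev] using hA f
  have hdense : DenseRange D.subtypeL := by
    simpa [DenseRange] using hD
  have hind : IsUniformInducing D.subtypeL := isUniformEmbedding_subtype_val.isUniformInducing
  let L : H →L[ℂ] H := K.extend D.subtypeL
  have hL : ∀ f : D, L f = f - A f := fun f => K.extend_eq hdense hind f
  have hbound : ∀ x, ‖L x‖ ≤ c * ‖x‖ := fun x =>
    hdense.induction_on (p := fun x => ‖L x‖ ≤ c * ‖x‖) x
      (isClosed_le (by fun_prop) (by fun_prop)) fun f => by
        change ‖L f‖ ≤ c * ‖f‖
        rw [hL, norm_sub_rev]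
        exact hA f
  have hnorm : ‖L‖ < 1 := (L.opNorm_le_bound hc0 hbound).trans_lt hc
  let u := Units.oneSub L hnorm
  refine ⟨(↑u⁻¹ : H →L[ℂ] H), fun f => ?_⟩
  have hu : (u : H →L[ℂ] H) f = A f := by
    change (1 - L) (f : H) = A f
    simp [hL]
  rw [← hu, ← mul_apply_eq_comp, u.inv_mul, one_apply_eq_self]

theorem stmt6 {H : Type*} [NormedAddCommGroup H] [InnerProductSpace ℂ H] [CompleteSpace H]
    (D : Submodule ℂ H) (hD : Dense (D : Set H))
    (ξ χ : ℕ → H)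
    (hrecon : ∀ f ∈ D,
      Tendsto (fun N => ∑ n ∈ Finset.range N, ⟪ξ n, f⟫ • χ n) atTop (𝓝 f))
    (φ ψ : ℕ → H) (β γ : ℝ) (hβ : 0 ≤ β) (hγ : 0 ≤ γ) (hβγ : β + γ < 1)
    (lam : ℂ) (hlam : lam ≠ 0)
    (h1 : ∀ f ∈ D, ∃ s : H,
      Tendsto (fun N => ∑ n ∈ Finset.range N, ⟪lam • φ n - ξ n, f⟫ • ψ n) atTop (𝓝 s) ∧
      ‖s‖ ≤ β * ‖f‖)
    (h2 : ∀ f ∈ D, ∃ s : H,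
      Tendsto (fun N => ∑ n ∈ Finset.range N, ⟪ξ n, f⟫ • (ψ n - χ n)) atTop (𝓝 s) ∧
      ‖s‖ ≤ γ * ‖f‖) :
    ∃ φt : ℕ → H, ∀ f ∈ D,
      Tendsto (fun N => ∑ n ∈ Finset.range N, ⟪φ n, f⟫ • φt n) atTop (𝓝 f) := by
  have key : ∀ f : D, ∃ a : H,
      Tendsto (fun N => ∑ n ∈ Finset.range N, ⟪lam • φ n, (f : H)⟫ • ψ n) atTop (𝓝 a) ∧
      ‖a - f‖ ≤ (β + γ) * ‖f‖ := by
    rintro ⟨f, hf⟩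
    obtain ⟨s, hs, hsn⟩ := h1 f hf
    obtain ⟨t, ht, htn⟩ := h2 f hf
    refine ⟨s + t + f, ?_, ?_⟩
    · refine ((hs.add ht).add (hrecon f hf)).congr fun N => ?_
      rw [← Finset.sum_add_distrib, ← Finset.sum_add_distrib]
      refine Finset.sum_congr rfl fun n _ => ?_
      rw [inner_sub_left]
      module
    · rw [add_sub_cancel_right, add_mul]
      exact (norm_add_le s t).trans (add_le_add hsn htn)
  choose a ha han using key
  let A : D →ₗ[ℂ] H :=
    { toFun := a
      map_add' := fun f g => tendsto_nhds_unique (ha (f + g)) <|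
        ((ha f).add (ha g)).congr fun N => by
          simp only [Submodule.coe_add, inner_add_right, add_smul, Finset.sum_add_distrib]
      map_smul' := fun c f => tendsto_nhds_unique (ha (c • f)) <|
        ((ha f).const_smul c).congr fun N => by
          simp only [Submodule.coe_smul, inner_smul_right, Finset.smul_sum, smul_smul] }
  obtain ⟨T, hT⟩ := exists_clm_leftInverse_of_norm_sub_le D hD A (add_nonneg hβ hγ) hβγ han
  refine ⟨fun n => starRingEnd ℂ lam • T (ψ n), fun f hf => ?_⟩
  have hlim := (T.continuous.tendsto _).comp (ha ⟨f, hf⟩)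
  rw [show T (a ⟨f, hf⟩) = f from hT ⟨f, hf⟩] at hlim
  refine hlim.congr fun N => ?_
  simp only [Function.comp_apply, map_sum, map_smul, inner_smul_left, smul_smul, mul_comm]
end

section
/- Let H be a complex Hilbert space, let D be a dense linear subspace of H, and let (ξ_n)_{n∈ℕ} and (χ_n)_{n∈ℕ} be sequences in H such that f = ∑_{n=0}^∞ ⟨ξ_n, f⟩ χ_n (convergence in norm) for all f ∈ D. Let (φ_n)_{n∈ℕ} be a sequence in H and λ a nonzero complex number such that (λφ_n − ξ_n)_{n∈ℕ} is a Bessel sequence with bound B₁ and (χ_n)_{n∈ℕ} is a Bessel sequence with bound B₂, where B₁B₂ < 1. Then there exists a sequence (φ̃_n)_{n∈ℕ} in H such that f = ∑_{n=0}^∞ ⟨φ_n, f⟩ φ̃_n for every f ∈ D. -/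
open scoped ComplexInnerProductSpace
open Filter Topology

/-- `θ` is a Bessel sequence for `H` with bound `B`:
`∑ₙ |⟨θ n, f⟩|² ≤ B‖f‖²` for every `f ∈ H`. -/
def IsBessel {H : Type*} [NormedAddCommGroup H] [InnerProductSpace ℂ H]
    (θ : ℕ → H) (B : ℝ) : Prop :=
  0 < B ∧ ∀ f : H,
    Summable (fun n => ‖⟪θ n, f⟫‖ ^ 2) ∧
    (∑' n, ‖⟪θ n, f⟫‖ ^ 2) ≤ B * ‖f‖ ^ 2

section BesselSynthesis

variable {H : Type*} [NormedAddCommGroup H] [InnerProductSpace ℂ H]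

theorem IsBessel.norm_sum_smul_sq_le {θ : ℕ → H} {B : ℝ} (h : IsBessel θ B) (c : ℕ → ℂ)
    (s : Finset ℕ) :
    ‖∑ n ∈ s, c n • θ n‖ ^ 2 ≤ B * ∑ n ∈ s, ‖c n‖ ^ 2 := by
  set v := ∑ n ∈ s, c n • θ n with hv
  have hS : 0 ≤ ∑ n ∈ s, ‖c n‖ ^ 2 := Finset.sum_nonneg fun _ _ => sq_nonneg _
  have hinner : ‖v‖ ^ 2 ≤ ∑ n ∈ s, ‖c n‖ * ‖⟪θ n, v⟫‖ := by
    calc ‖v‖ ^ 2 = ‖⟪v, v⟫‖ := by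
          rw [inner_self_eq_norm_sq_to_K]; simp
      _ = ‖∑ n ∈ s, c n * ⟪v, θ n⟫‖ := by
          conv_lhs => rw [hv, inner_sum, ← hv]
          simp only [inner_smul_right]
      _ ≤ ∑ n ∈ s, ‖c n * ⟪v, θ n⟫‖ := norm_sum_le _ _
      _ = ∑ n ∈ s, ‖c n‖ * ‖⟪θ n, v⟫‖ := by
          simp only [norm_mul, norm_inner_symm v]
  have hbessel : ∑ n ∈ s, ‖⟪θ n, v⟫‖ ^ 2 ≤ B * ‖v‖ ^ 2 :=
    ((h.2 v).1.sum_le_tsum s fun _ _ => sq_nonneg _).trans (h.2 v).2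
  have hfour : (‖v‖ ^ 2) * (‖v‖ ^ 2) ≤ (B * ∑ n ∈ s, ‖c n‖ ^ 2) * ‖v‖ ^ 2 := by
    calc (‖v‖ ^ 2) * (‖v‖ ^ 2) = (‖v‖ ^ 2) ^ 2 := by ring
      _ ≤ (∑ n ∈ s, ‖c n‖ * ‖⟪θ n, v⟫‖) ^ 2 := by gcongr
      _ ≤ (∑ n ∈ s, ‖c n‖ ^ 2) * ∑ n ∈ s, ‖⟪θ n, v⟫‖ ^ 2 :=
          Finset.sum_mul_sq_le_sq_mul_sq _ _ _
      _ ≤ (∑ n ∈ s, ‖c n‖ ^ 2) * (B * ‖v‖ ^ 2) := by gcongr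
      _ = (B * ∑ n ∈ s, ‖c n‖ ^ 2) * ‖v‖ ^ 2 := by ring
  rcases (sq_nonneg ‖v‖).eq_or_lt with h0 | hpos
  · rw [← h0]
    exact mul_nonneg h.1.le hS
  · exact le_of_mul_le_mul_right hfour hpos

theorem IsBessel.summable_smul [CompleteSpace H] {θ : ℕ → H} {B : ℝ} (h : IsBessel θ B)
    {c : ℕ → ℂ} (hc : Summable fun n => ‖c n‖ ^ 2) : Summable fun n => c n • θ n := by
  rw [summable_iff_vanishing_norm]
  intro ε hε
  have hB := h.1
  obtain ⟨s, hs⟩ := summable_iff_vanishing_norm.1 hc (ε ^ 2 / B) (by positivity)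
  refine ⟨s, fun t ht => lt_of_pow_lt_pow_left₀ 2 hε.le ?_⟩
  have hlt := (le_abs_self _).trans_lt (hs t ht)
  rw [lt_div_iff₀ hB] at hlt
  linarith [h.norm_sum_smul_sq_le c t]

theorem IsBessel.norm_tsum_smul_sq_le [CompleteSpace H] {θ : ℕ → H} {B : ℝ} (h : IsBessel θ B)
    {c : ℕ → ℂ} (hc : Summable fun n => ‖c n‖ ^ 2) :
    ‖∑' n, c n • θ n‖ ^ 2 ≤ B * ∑' n, ‖c n‖ ^ 2 :=
  le_of_tendsto_of_tendsto' ((h.summable_smul hc).hasSum.norm.pow 2)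
    (Filter.Tendsto.const_mul B hc.hasSum)
    (h.norm_sum_smul_sq_le c)

/-- The mixed frame operator `f ↦ ∑ₙ ⟨θ n, f⟩ χ n` of two Bessel sequences is bounded, with norm
at most the geometric mean of the Bessel bounds. -/
theorem IsBessel.exists_mixedFrameOperator [CompleteSpace H] {θ χ : ℕ → H} {B₁ B₂ : ℝ}
    (hθ : IsBessel θ B₁) (hχ : IsBessel χ B₂) :
    ∃ T : H →L[ℂ] H, ‖T‖ ≤ √(B₁ * B₂) ∧ ∀ f, HasSum (fun n => ⟪θ n, f⟫ • χ n) (T f) := by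
  have hsum (f : H) : Summable fun n => ⟪θ n, f⟫ • χ n := hχ.summable_smul (hθ.2 f).1
  let L : H →ₗ[ℂ] H :=
    { toFun := fun f => ∑' n, ⟪θ n, f⟫ • χ n
      map_add' := fun f g => by
        simp only [inner_add_right, add_smul]
        exact (hsum f).tsum_add (hsum g)
      map_smul' := fun a f => by
        simp only [inner_smul_right, mul_smul, RingHom.id_apply]
        exact (hsum f).tsum_const_smul a }
  have hL (f : H) : ‖L f‖ ≤ √(B₁ * B₂) * ‖f‖ := by
    have hB₁ := hθ.1
    have hB₂ := hχ.1
    refine le_of_pow_le_pow_left₀ two_ne_zero (by positivity) ?_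
    calc ‖L f‖ ^ 2 ≤ B₂ * ∑' n, ‖⟪θ n, f⟫‖ ^ 2 := hχ.norm_tsum_smul_sq_le (hθ.2 f).1
      _ ≤ B₂ * (B₁ * ‖f‖ ^ 2) := by gcongr; exact (hθ.2 f).2
      _ = (√(B₁ * B₂) * ‖f‖) ^ 2 := by
          rw [mul_pow, Real.sq_sqrt (by positivity)]; ring
  exact ⟨L.mkContinuous _ hL, L.mkContinuous_norm_le (Real.sqrt_nonneg _) hL,
    fun f => (hsum f).hasSum⟩

end BesselSynthesis

theorem stmt7 {H : Type*} [NormedAddCommGroup H] [InnerProductSpace ℂ H] [CompleteSpace H]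
    (D : Submodule ℂ H) (hD : Dense (D : Set H))
    (ξ χ : ℕ → H)
    (hrecon : ∀ f ∈ D,
      Tendsto (fun N => ∑ n ∈ Finset.range N, ⟪ξ n, f⟫ • χ n) atTop (𝓝 f))
    (φ : ℕ → H) (lam : ℂ) (hlam : lam ≠ 0) (B₁ B₂ : ℝ)
    (hB1 : IsBessel (fun n => lam • φ n - ξ n) B₁)
    (hB2 : IsBessel χ B₂)
    (hB : B₁ * B₂ < 1) :
    ∃ φt : ℕ → H, ∀ f ∈ D,
      Tendsto (fun N => ∑ n ∈ Finset.range N, ⟪φ n, f⟫ • φt n) atTop (𝓝 f) := by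
  obtain ⟨T, hT, hTsum⟩ := hB1.exists_mixedFrameOperator hB2
  have hT_lt : ‖-T‖ < 1 := by
    rw [norm_neg]
    exact hT.trans_lt ((Real.sqrt_lt' one_pos).2 (by simpa using hB))
  let U := Units.oneSub (-T) hT_lt
  let S : H →L[ℂ] H := ↑U⁻¹
  have hS (f : H) : S (f + T f) = f := by
    have h := congrArg (fun A : H →L[ℂ] H => A f) U.inv_mul
    simpa [U, S] using h
  refine ⟨fun n => (starRingEnd ℂ lam) • S (χ n), fun f hf => ?_⟩
  have hadd := (hrecon f hf).add (hTsum f).tendsto_sum_nat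
  have hlim := (S.continuous.tendsto _).comp hadd
  rw [hS] at hlim
  refine hlim.congr fun N => ?_
  simp only [Function.comp_apply, ← Finset.sum_add_distrib, ← add_smul, map_sum, map_smul]
  refine Finset.sum_congr rfl fun n _ => ?_
  rw [inner_sub_left, inner_smul_left, add_sub_cancel, smul_smul, mul_comm]
end

section
/- Let H be a complex Hilbert space, let D be a dense linear subspace of H, and let (ξ_n)_{n∈ℕ} and (χ_n)_{n∈ℕ} be sequences in H such that f = ∑_{n=0}^∞ ⟨ξ_n, f⟩ χ_n (convergence in norm) for all f ∈ D. Let (φ_n)_{n∈ℕ} and (ψ_n)_{n∈ℕ} be sequences in H and λ a nonzero complex number such that ∑_{n=0}^∞ ( ‖λφ_n − ξ_n‖·‖ψ_n‖ + ‖ξ_n‖·‖ψ_n − χ_n‖ ) < 1. Then there exists a sequence (φ̃_n)_{n∈ℕ} in H such that f = ∑_{n=0}^∞ ⟨φ_n, f⟩ φ̃_n for every f ∈ D. -/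
open scoped ComplexInnerProductSpace
open Filter Topology

/-- The operator `f ↦ ⟪ξ, f⟫ χ - ⟪η, f⟫ ψ`, a difference of two rank-one operators. -/
noncomputable def rankOneDiff {H : Type*} [NormedAddCommGroup H] [InnerProductSpace ℂ H]
    (ξ χ η ψ : H) : H →L[ℂ] H :=
  (innerSL ℂ ξ).smulRight χ - (innerSL ℂ η).smulRight ψ

theorem rankOneDiff_apply {H : Type*} [NormedAddCommGroup H] [InnerProductSpace ℂ H]
    (ξ χ η ψ f : H) : rankOneDiff ξ χ η ψ f = ⟪ξ, f⟫ • χ - ⟪η, f⟫ • ψ := by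
  simp [rankOneDiff]

theorem norm_rankOneDiff_le {H : Type*} [NormedAddCommGroup H] [InnerProductSpace ℂ H]
    (ξ χ η ψ : H) :
    ‖rankOneDiff ξ χ η ψ‖ ≤ ‖η - ξ‖ * ‖ψ‖ + ‖ξ‖ * ‖ψ - χ‖ := by
  have h : rankOneDiff ξ χ η ψ =
      -((innerSL ℂ (η - ξ)).smulRight ψ + (innerSL ℂ ξ).smulRight (ψ - χ)) := by
    ext f
    simp only [rankOneDiff_apply, neg_apply, add_apply,
      ContinuousLinearMap.smulRight_apply, innerSL_apply_apply, inner_sub_left]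
    module
  rw [h, norm_neg]
  refine (norm_add_le _ _).trans_eq ?_
  simp only [ContinuousLinearMap.norm_smulRight_apply, innerSL_apply_norm]

theorem stmt8 {H : Type*} [NormedAddCommGroup H] [InnerProductSpace ℂ H] [CompleteSpace H]
    (D : Submodule ℂ H) (hD : Dense (D : Set H))
    (ξ χ : ℕ → H)
    (hrecon : ∀ f ∈ D,
      Tendsto (fun N => ∑ n ∈ Finset.range N, ⟪ξ n, f⟫ • χ n) atTop (𝓝 f))
    (φ ψ : ℕ → H) (lam : ℂ) (hlam : lam ≠ 0)
    (hsum : Summable (fun n => ‖lam • φ n - ξ n‖ * ‖ψ n‖ + ‖ξ n‖ * ‖ψ n - χ n‖))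
    (hlt : (∑' n, (‖lam • φ n - ξ n‖ * ‖ψ n‖ + ‖ξ n‖ * ‖ψ n - χ n‖)) < 1) :
    ∃ φt : ℕ → H, ∀ f ∈ D,
      Tendsto (fun N => ∑ n ∈ Finset.range N, ⟪φ n, f⟫ • φt n) atTop (𝓝 f) := by
  set A : ℕ → H →L[ℂ] H := fun n => rankOneDiff (ξ n) (χ n) (lam • φ n) (ψ n)
  have hA (n : ℕ) : ‖A n‖ ≤ ‖lam • φ n - ξ n‖ * ‖ψ n‖ + ‖ξ n‖ * ‖ψ n - χ n‖ :=
    norm_rankOneDiff_le _ _ _ _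
  have hAsum : Summable A := .of_norm_bounded hsum hA
  have hnorm : ‖∑' n, A n‖ < 1 := (tsum_of_norm_bounded hsum.hasSum hA).trans_lt hlt
  obtain ⟨u, hu⟩ := isUnit_one_sub_of_norm_lt_one hnorm
  refine ⟨fun n => (starRingEnd ℂ) lam • (↑u⁻¹ : H →L[ℂ] H) (ψ n), fun f hf => ?_⟩
  have hK : Tendsto (fun N => ∑ n ∈ Finset.range N, A n f) atTop (𝓝 ((∑' n, A n) f)) :=
    (hAsum.hasSum.mapL (ContinuousLinearMap.apply ℂ H f)).tendsto_sum_nat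
  have hT : Tendsto (fun N => ∑ n ∈ Finset.range N, ⟪lam • φ n, f⟫ • ψ n) atTop
      (𝓝 ((u : H →L[ℂ] H) f)) := by
    simpa [A, rankOneDiff_apply, hu, Finset.sum_sub_distrib] using (hrecon f hf).sub hK
  have hinv : (↑u⁻¹ : H →L[ℂ] H) ((u : H →L[ℂ] H) f) = f := by
    rw [← mul_apply_eq_comp, u.inv_mul, one_apply_eq_self]
  have h := ((↑u⁻¹ : H →L[ℂ] H).continuous.tendsto _).comp hT
  rw [hinv] at h
  refine h.congr fun N => ?_
  simp only [Function.comp_apply, map_sum, map_smul, inner_smul_left, smul_smul, mul_comm]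
end

section
/- Let H be a complex Hilbert space and let (φ_n)_{n∈ℕ} and (φ̃_n)_{n∈ℕ} be sequences in H such that f = ∑_{n=0}^∞ ⟨φ_n, f⟩ φ̃_n (convergence in norm) for every f ∈ H. Let (ψ_n)_{n∈ℕ} be a sequence in H, let 0 ≤ α < 1, and let λ be a nonzero complex number such that ‖∑_n c_n (λψ_n − φ̃_n)‖ ≤ α ‖∑_n c_n φ̃_n‖ for every finitely supported complex sequence (c_n). Then there exists a sequence (ψ̃_n)_{n∈ℕ} in H such that f = ∑_{n=0}^∞ ⟨ψ̃_n, f⟩ ψ_n for every f ∈ H. -/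
open scoped ComplexInnerProductSpace
open Filter Topology

/-- An inequality between finitely supported combinations, restated over an arbitrary finset. -/
lemma norm_sum_smul_le_of_forall_finsupp {ι E F : Type*} [NormedAddCommGroup E] [NormedSpace ℂ E]
    [NormedAddCommGroup F] [NormedSpace ℂ F] {u : ι → E} {v : ι → F} {α : ℝ}
    (h : ∀ c : ι →₀ ℂ, ‖∑ n ∈ c.support, c n • u n‖ ≤ α * ‖∑ n ∈ c.support, c n • v n‖)
    (s : Finset ι) (c : ι → ℂ) :
    ‖∑ n ∈ s, c n • u n‖ ≤ α * ‖∑ n ∈ s, c n • v n‖ := by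
  classical
  let d : ι →₀ ℂ := Finsupp.indicator s fun i _ => c i
  have hd : ∀ n ∈ s, d n = c n := fun n hn => Finsupp.indicator_of_mem hn _
  have := h d
  rwa [Finset.sum_subset (Finsupp.support_indicator_subset s _)
      fun n _ hn => by rw [Finsupp.notMem_support_iff.mp hn, zero_smul],
    Finset.sum_subset (Finsupp.support_indicator_subset s _)
      fun n _ hn => by rw [Finsupp.notMem_support_iff.mp hn, zero_smul],
    Finset.sum_congr rfl fun n hn => by rw [hd n hn],
    Finset.sum_congr (g := fun n => c n • v n) rfl fun n hn => by rw [hd n hn]] at this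

/-- If partial sums of `u` over every finset are dominated by those of `v`, convergence of the
series of `v` implies that of `u`. -/
lemma exists_tendsto_sum_range_of_norm_sum_le {E F : Type*} [NormedAddCommGroup E]
    [CompleteSpace E] [NormedAddCommGroup F] {u : ℕ → E} {v : ℕ → F} {α : ℝ} (hα : 0 ≤ α)
    (h : ∀ s : Finset ℕ, ‖∑ n ∈ s, u n‖ ≤ α * ‖∑ n ∈ s, v n‖) {b : F}
    (hv : Tendsto (fun N => ∑ n ∈ Finset.range N, v n) atTop (𝓝 b)) :
    ∃ a, Tendsto (fun N => ∑ n ∈ Finset.range N, u n) atTop (𝓝 a) ∧ ‖a‖ ≤ α * ‖b‖ := by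
  have hc : CauchySeq fun N => ∑ n ∈ Finset.range N, u n := by
    rw [Metric.cauchySeq_iff']
    intro ε hε
    obtain ⟨N, hN⟩ :=
      Metric.cauchySeq_iff'.mp hv.cauchySeq (ε / (α + 1)) (by positivity)
    refine ⟨N, fun n hn => ?_⟩
    rw [dist_eq_norm]
    have h1 := h (Finset.Ico N n)
    rw [Finset.sum_Ico_eq_sub _ hn, Finset.sum_Ico_eq_sub _ hn] at h1
    have h2 := hN n hn
    rw [dist_eq_norm, lt_div_iff₀ (by positivity)] at h2
    nlinarith [norm_nonneg (∑ k ∈ Finset.range n, v k - ∑ k ∈ Finset.range N, v k)]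
  obtain ⟨a, ha⟩ := cauchySeq_tendsto_of_complete hc
  exact ⟨a, ha, le_of_tendsto_of_tendsto' ha.norm (hv.norm.const_mul α) fun N => h _⟩

theorem stmt9 {H : Type*} [NormedAddCommGroup H] [InnerProductSpace ℂ H] [CompleteSpace H]
    (φ φt ψ : ℕ → H)
    (hrecon : ∀ f : H,
      Tendsto (fun N => ∑ n ∈ Finset.range N, ⟪φ n, f⟫ • φt n) atTop (𝓝 f))
    (α : ℝ) (hα0 : 0 ≤ α) (hα1 : α < 1) (lam : ℂ) (hlam : lam ≠ 0)
    (hpert : ∀ c : ℕ →₀ ℂ,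
      ‖∑ n ∈ c.support, c n • (lam • ψ n - φt n)‖ ≤ α * ‖∑ n ∈ c.support, c n • φt n‖) :
    ∃ ψt : ℕ → H, ∀ f : H,
      Tendsto (fun N => ∑ n ∈ Finset.range N, ⟪ψt n, f⟫ • ψ n) atTop (𝓝 f) := by
  choose T hT hTnorm using fun f : H => exists_tendsto_sum_range_of_norm_sum_le hα0
    (fun s => norm_sum_smul_le_of_forall_finsupp hpert s fun n => ⟪φ n, f⟫) (hrecon f)
  let L : H →ₗ[ℂ] H :=
    { toFun := T
      map_add' := fun f g => tendsto_nhds_unique (hT (f + g)) <| by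
        simpa only [inner_add_right, add_smul, Finset.sum_add_distrib] using (hT f).add (hT g)
      map_smul' := fun c f => tendsto_nhds_unique (hT (c • f)) <| by
        simpa only [inner_smul_right, mul_smul, Finset.smul_sum, RingHom.id_apply]
          using (hT f).const_smul c }
  let K : H →L[ℂ] H := L.mkContinuous α hTnorm
  have hK : ‖-K‖ < 1 := by
    rw [norm_neg]
    exact (L.mkContinuous_norm_le hα0 hTnorm).trans_lt hα1
  obtain ⟨B, hB⟩ := (isUnit_one_sub_of_norm_lt_one hK).exists_right_inv
  refine ⟨fun n => star lam • B.adjoint (φ n), fun f => ?_⟩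
  have hf : B f + T (B f) = f := by
    have := congrArg (fun A : H →L[ℂ] H => A f) hB
    simpa [K, L, sub_neg_eq_add] using this
  have h := (hrecon (B f)).add (hT (B f))
  rw [hf] at h
  refine h.congr fun N => ?_
  rw [← Finset.sum_add_distrib]
  refine Finset.sum_congr rfl fun n _ => ?_
  rw [← smul_add, add_sub_cancel, inner_smul_left, ContinuousLinearMap.adjoint_inner_left,
    smul_smul, mul_comm]
  simp
end

section
/- Let H be a complex Hilbert space and let (φ_n)_{n∈ℕ} and (ψ_n)_{n∈ℕ} be sequences in H such that the complex series ∑_{n=0}^∞ ⟨f, φ_n⟩⟨ψ_n, g⟩ converges for every f, g ∈ H. Suppose there exist α with 0 ≤ α < 1 and a nonzero complex number λ such that |λ ∑_{n=0}^∞ ⟨f, φ_n⟩⟨ψ_n, g⟩ − ⟨f, g⟩| ≤ α‖f‖‖g‖ for all f, g ∈ H. Then there exist sequences (φ̃_n)_{n∈ℕ} and (ψ̃_n)_{n∈ℕ} in H such that ⟨f, g⟩ = ∑_{n=0}^∞ ⟨f, φ_n⟩⟨φ̃_n, g⟩ = ∑_{n=0}^∞ ⟨f, ψ_n⟩⟨ψ̃_n,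 g⟩ for all f, g ∈ H, and moreover ⟨φ_n, φ̃_m⟩ = ⟨ψ̃_n, ψ_m⟩ for all n, m ∈ ℕ. -/
open scoped ComplexInnerProductSpace
open Filter Topology

/-- A bounded sesquilinear form is represented by a bounded operator. -/
theorem exists_clm_inner_eq_of_sesquilinear_bound {H : Type*} [NormedAddCommGroup H]
    [InnerProductSpace ℂ H] [CompleteSpace H] (S : H → H → ℂ) (C : ℝ)
    (hadd_left : ∀ f f' g, S (f + f') g = S f g + S f' g)
    (hsmul_left : ∀ (c : ℂ) f g, S (c • f) g = (starRingEnd ℂ) c • S f g)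
    (hadd_right : ∀ f g g', S f (g + g') = S f g + S f g')
    (hsmul_right : ∀ (c : ℂ) f g, S f (c • g) = c • S f g)
    (hC : ∀ f g, ‖S f g‖ ≤ C * ‖f‖ * ‖g‖) :
    ∃ A : H →L[ℂ] H, ∀ f g, ⟪A f, g⟫ = S f g := by
  let B : H →ₗ⋆[ℂ] H →ₗ[ℂ] ℂ := LinearMap.mk₂'ₛₗ (starRingEnd ℂ) (RingHom.id ℂ) S
    hadd_left hsmul_left hadd_right hsmul_right
  refine ⟨InnerProductSpace.continuousLinearMapOfBilin (B.mkContinuous₂ C hC), fun f g => ?_⟩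
  rw [InnerProductSpace.continuousLinearMapOfBilin_apply]
  rfl

/-- An operator whose scaled form differs from the inner product by a factor less than one
is invertible. -/
theorem isUnit_of_norm_mul_inner_sub_inner_le {H : Type*} [NormedAddCommGroup H]
    [InnerProductSpace ℂ H] [CompleteSpace H] (A : H →L[ℂ] H) {α : ℝ} (hα0 : 0 ≤ α) (hα1 : α < 1)
    {c : ℂ} (hc : c ≠ 0) (h : ∀ f g, ‖c * ⟪A f, g⟫ - ⟪f, g⟫‖ ≤ α * ‖f‖ * ‖g‖) :
    IsUnit A := by
  have hd : (starRingEnd ℂ) c ≠ 0 := by simpa using hc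
  have hnorm : ‖1 - (starRingEnd ℂ) c • A‖ ≤ α := by
    refine ContinuousLinearMap.opNorm_le_bound _ hα0 fun f => ?_
    set v := (1 - (starRingEnd ℂ) c • A) f with hv
    have hinner : ∀ g, ⟪v, g⟫ = -(c * ⟪A f, g⟫ - ⟪f, g⟫) := fun g => by
      simp [hv, mul_comm]
    have hle := h f v
    rw [← norm_neg, ← hinner v, inner_self_eq_norm_sq_to_K] at hle
    simp only [norm_pow, Complex.coe_algebraMap, Complex.norm_real, norm_norm] at hle
    rcases (norm_nonneg v).eq_or_lt with h0 | h0
    · rw [← h0]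
      positivity
    · exact le_of_mul_le_mul_right (by simpa [sq] using hle) h0
  have hu : IsUnit ((starRingEnd ℂ) c • A) := by
    simpa using isUnit_one_sub_of_norm_lt_one (hnorm.trans_lt hα1)
  simpa [Units.smul_def, inv_smul_smul₀ hd] using hu.smul (Units.mk0 _ (inv_ne_zero hd))

theorem stmt10 {H : Type*} [NormedAddCommGroup H] [InnerProductSpace ℂ H] [CompleteSpace H]
    (φ ψ : ℕ → H) (α : ℝ) (hα0 : 0 ≤ α) (hα1 : α < 1) (lam : ℂ) (hlam : lam ≠ 0)
    (h : ∀ f g : H, ∃ S : ℂ,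
      Tendsto (fun N => ∑ n ∈ Finset.range N, ⟪f, φ n⟫ * ⟪ψ n, g⟫) atTop (𝓝 S) ∧
      ‖lam * S - ⟪f, g⟫‖ ≤ α * ‖f‖ * ‖g‖) :
    ∃ φt ψt : ℕ → H,
      (∀ f g : H,
        Tendsto (fun N => ∑ n ∈ Finset.range N, ⟪f, φ n⟫ * ⟪φt n, g⟫) atTop (𝓝 ⟪f, g⟫) ∧
        Tendsto (fun N => ∑ n ∈ Finset.range N, ⟪f, ψ n⟫ * ⟪ψt n, g⟫) atTop (𝓝 ⟪f, g⟫)) ∧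
      ∀ n m : ℕ, ⟪φ n, φt m⟫ = ⟪ψt n, ψ m⟫ := by
  choose S hS hbound using h
  obtain ⟨A, hA⟩ : ∃ A : H →L[ℂ] H, ∀ f g, ⟪A f, g⟫ = S f g := by
    refine exists_clm_inner_eq_of_sesquilinear_bound S ((α + 1) / ‖lam‖) ?_ ?_ ?_ ?_ ?_
    · intro f f' g
      refine tendsto_nhds_unique (hS _ _) (((hS f g).add (hS f' g)).congr fun N => ?_)
      simp [add_mul, Finset.sum_add_distrib]
    · intro c f g
      refine tendsto_nhds_unique (hS _ _) (((hS f g).const_smul _).congr fun N => ?_)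
      simp [Finset.mul_sum, mul_left_comm, mul_assoc]
    · intro f g g'
      refine tendsto_nhds_unique (hS _ _) (((hS f g).add (hS f g')).congr fun N => ?_)
      simp [mul_add, Finset.sum_add_distrib]
    · intro c f g
      refine tendsto_nhds_unique (hS _ _) (((hS f g).const_smul _).congr fun N => ?_)
      simp [Finset.mul_sum, mul_left_comm]
    · intro f g
      have hpos : 0 < ‖lam‖ := norm_pos_iff.mpr hlam
      have htri : ‖lam * S f g‖ ≤ ‖lam * S f g - ⟪f, g⟫‖ + ‖⟪f, g⟫‖ := by
        simpa using norm_add_le (lam * S f g - ⟪f, g⟫) ⟪f, g⟫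
      rw [norm_mul] at htri
      have hcs : ‖⟪f, g⟫‖ ≤ ‖f‖ * ‖g‖ := norm_inner_le_norm f g
      have hb := hbound f g
      rw [div_mul_eq_mul_div, div_mul_eq_mul_div, le_div_iff₀ hpos]
      linarith
  obtain ⟨⟨A', R, hAR, hRA⟩, rfl⟩ := isUnit_of_norm_mul_inner_sub_inner_le A hα0 hα1 hlam
    fun f g => by simpa only [hA] using hbound f g
  have hAR' : ∀ x, A' (R x) = x := fun x => DFunLike.congr_fun hAR x
  have hRA' : ∀ x, R (A' x) = x := fun x => DFunLike.congr_fun hRA x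
  refine ⟨fun n => R (ψ n), fun n => R.adjoint (φ n), fun f g => ⟨?_, ?_⟩, fun n m => ?_⟩
  · have hlim := hS f (R.adjoint g)
    rw [← hA, ContinuousLinearMap.adjoint_inner_right, hRA'] at hlim
    simpa only [ContinuousLinearMap.adjoint_inner_right] using hlim
  · have hlim := (Complex.continuous_conj.tendsto _).comp (hS (R g) f)
    rw [← hA, hAR', inner_conj_symm] at hlim
    refine hlim.congr fun N => ?_
    simp [ContinuousLinearMap.adjoint_inner_left, mul_comm]
  · exact (ContinuousLinearMap.adjoint_inner_left R (ψ m) (φ n)).symm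
end

section
/- Let H be a complex Hilbert space and let (η_n)_{n∈ℕ} and (χ_n)_{n∈ℕ} be sequences in H such that f = ∑_{n=0}^∞ ⟨η_n, f⟩ χ_n (convergence in norm) for every f ∈ H. Let X, Y : H → H be bounded linear operators with ‖X‖ + ‖Y‖ + ‖X‖·‖Y‖ < 1, and set φ_n = (I + X)η_n and ψ_n = (I + Y)χ_n for all n. Then for every f ∈ H the series ∑_{n=0}^∞ ⟨φ_n, f⟩ ψ_n converges in H and ‖∑_{n=0}^∞ ⟨φ_n, f⟩ ψ_n − f‖ ≤ (‖X‖ + ‖Y‖ + ‖X‖·‖Y‖) ‖f‖. -/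
open scoped ComplexInnerProductSpace
open Filter Topology

theorem stmt13 {H : Type*} [NormedAddCommGroup H] [InnerProductSpace ℂ H] [CompleteSpace H]
    (η χ : ℕ → H)
    (hrecon : ∀ f : H,
      Tendsto (fun N => ∑ n ∈ Finset.range N, ⟪η n, f⟫ • χ n) atTop (𝓝 f))
    (X Y : H →L[ℂ] H) (hXY : ‖X‖ + ‖Y‖ + ‖X‖ * ‖Y‖ < 1)
    (φ ψ : ℕ → H)
    (hφ : ∀ n, φ n = η n + X (η n)) (hψ : ∀ n, ψ n = χ n + Y (χ n)) :
    ∀ f : H, ∃ s : H,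
      Tendsto (fun N => ∑ n ∈ Finset.range N, ⟪φ n, f⟫ • ψ n) atTop (𝓝 s) ∧
      ‖s - f‖ ≤ (‖X‖ + ‖Y‖ + ‖X‖ * ‖Y‖) * ‖f‖ := by
  intro f
  set g : H := f + X.adjoint f with hg
  have hcoeff : ∀ n, ⟪φ n, f⟫ = ⟪η n, g⟫ := fun n => by
    rw [hφ, hg, inner_add_left, inner_add_right, ContinuousLinearMap.adjoint_inner_right]
  refine ⟨g + Y g, ?_, ?_⟩
  · have hlim := (hrecon g).add ((Y.continuous.tendsto g).comp (hrecon g))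
    refine hlim.congr fun N => ?_
    simp [hcoeff, hψ, smul_add, Finset.sum_add_distrib]
  · have hadj : ‖X.adjoint f‖ ≤ ‖X‖ * ‖f‖ := by
      simpa using X.adjoint.le_opNorm f
    have hYadj : ‖Y (X.adjoint f)‖ ≤ ‖Y‖ * (‖X‖ * ‖f‖) := Y.le_opNorm_of_le hadj
    calc ‖g + Y g - f‖ = ‖X.adjoint f + Y f + Y (X.adjoint f)‖ := by
          rw [hg, map_add]
          congr 1
          abel
      _ ≤ ‖X.adjoint f‖ + ‖Y f‖ + ‖Y (X.adjoint f)‖ := norm_add₃_le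
      _ ≤ ‖X‖ * ‖f‖ + ‖Y‖ * ‖f‖ + ‖Y‖ * (‖X‖ * ‖f‖) :=
          add_le_add (add_le_add hadj (Y.le_opNorm f)) hYadj
      _ = (‖X‖ + ‖Y‖ + ‖X‖ * ‖Y‖) * ‖f‖ := by ring
end

section
/- Let H be a complex Hilbert space and let (φ_n)_{n∈ℕ} and (φ̃_n)_{n∈ℕ} be sequences in H such that f = ∑_{n=0}^∞ ⟨φ_n, f⟩ φ̃_n (convergence in norm) for every f ∈ H. If for every f ∈ H the series ∑_{n=0}^∞ ⟨φ̃_n, f⟩ φ_n converges in H, then its sum equals f, i.e. f = ∑_{n=0}^∞ ⟨φ̃_n, f⟩ φ_n for every f ∈ H. -/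
open scoped ComplexInnerProductSpace
open Filter Topology

theorem stmt17 {H : Type*} [NormedAddCommGroup H] [InnerProductSpace ℂ H] [CompleteSpace H]
    (φ φt : ℕ → H)
    (hrecon : ∀ f : H,
      Tendsto (fun N => ∑ n ∈ Finset.range N, ⟪φ n, f⟫ • φt n) atTop (𝓝 f))
    (hconv : ∀ f : H, ∃ s : H,
      Tendsto (fun N => ∑ n ∈ Finset.range N, ⟪φt n, f⟫ • φ n) atTop (𝓝 s)) :
    ∀ f : H,
      Tendsto (fun N => ∑ n ∈ Finset.range N, ⟪φt n, f⟫ • φ n) atTop (𝓝 f) := by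
  intro f
  obtain ⟨s, hs⟩ := hconv f
  suffices h : s = f by rwa [h] at hs
  refine ext_inner_left ℂ fun g => ?_
  have adjoint_sum (N : ℕ) : ⟪g, ∑ n ∈ Finset.range N, ⟪φt n, f⟫ • φ n⟫ =
      ⟪∑ n ∈ Finset.range N, ⟪φ n, g⟫ • φt n, f⟫ := by
    simp only [inner_sum, sum_inner, inner_smul_left, inner_smul_right, inner_conj_symm]
    exact Finset.sum_congr rfl fun n _ => mul_comm _ _
  refine tendsto_nhds_unique (tendsto_const_nhds.inner hs) ?_
  simp only [adjoint_sum]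
  exact (hrecon g).inner tendsto_const_nhds
end

section
/- For every natural number n and every real number α, the integral ∫_ℝ H_n(x) e^{−x² − √2 α x} dx equals √π · e^{α²/2} · (−√2 α)^n, where H_n denotes the n-th physicist Hermite polynomial. -/
open Filter Topology

/-- The `n`-th physicist Hermite polynomial, via Rodrigues' formula:
`H_n(x) = (-1)^n e^{x²} (d/dx)^n e^{-x²}`. -/
noncomputable def physHermite (n : ℕ) (x : ℝ) : ℝ :=
  (-1 : ℝ) ^ n * Real.exp (x ^ 2) * iteratedDeriv n (fun y => Real.exp (-y ^ 2)) x

open MeasureTheory Polynomial in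
/-- A real polynomial times the Gaussian `e^{-x²}` is integrable. -/
theorem Polynomial.integrable_eval_mul_exp_neg_sq (p : ℝ[X]) :
    Integrable fun x : ℝ => p.eval x * Real.exp (-x ^ 2) := by
  induction p using Polynomial.induction_on' with
  | add p q hp hq => simpa only [eval_add, add_mul] using! hp.add hq
  | monomial k a =>
    have h := integrable_rpow_mul_exp_neg_mul_sq one_pos
      (neg_one_lt_zero.trans_le (Nat.cast_nonneg (α := ℝ) k))
    simpa [mul_assoc] using h.const_mul a

/-- Completing the square in a Gaussian with a linear term. -/
theorem exp_neg_sq_mul_exp_neg_mul (b x : ℝ) :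
    Real.exp (-x ^ 2) * Real.exp (-(b * x)) =
      Real.exp (-(x + b / 2) ^ 2) * Real.exp (b ^ 2 / 4) := by
  rw [← Real.exp_add, ← Real.exp_add]
  ring_nf

open MeasureTheory Polynomial in
theorem Polynomial.integrable_eval_mul_exp_neg_sq_mul_exp (p : ℝ[X]) (b : ℝ) :
    Integrable fun x : ℝ => p.eval x * Real.exp (-x ^ 2) * Real.exp (-(b * x)) := by
  have h := (((p.comp (X - C (b / 2))).integrable_eval_mul_exp_neg_sq.comp_add_right
    (b / 2)).mul_const (Real.exp (b ^ 2 / 4)))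
  refine h.congr (.of_forall fun x => ?_)
  simp [mul_assoc, exp_neg_sq_mul_exp_neg_mul]

theorem integral_exp_neg_sq_mul_exp_neg_mul (b : ℝ) :
    ∫ x : ℝ, Real.exp (-x ^ 2) * Real.exp (-(b * x)) =
      Real.sqrt Real.pi * Real.exp (b ^ 2 / 4) := by
  simp_rw [exp_neg_sq_mul_exp_neg_mul]
  rw [MeasureTheory.integral_mul_const,
    MeasureTheory.integral_add_right_eq_self (fun x : ℝ => Real.exp (-x ^ 2)) (b / 2)]
  congr 1
  simpa using integral_gaussian 1

theorem contDiff_exp_neg_sq (n : ℕ) : ContDiff ℝ n fun y : ℝ => Real.exp (-y ^ 2) := by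
  fun_prop

open Polynomial in
/-- Every iterated derivative of `e^{-x²}` is a polynomial multiple of `e^{-x²}`. -/
theorem exists_iteratedDeriv_exp_neg_sq_eq (n : ℕ) :
    ∃ p : ℝ[X], iteratedDeriv n (fun y : ℝ => Real.exp (-y ^ 2)) =
      fun x => p.eval x * Real.exp (-x ^ 2) := by
  induction n with
  | zero => exact ⟨1, by simp⟩
  | succ n ih =>
    obtain ⟨p, hp⟩ := ih
    refine ⟨derivative p - C 2 * X * p, ?_⟩
    rw [iteratedDeriv_succ, hp]
    funext x
    have h := (p.hasDerivAt x).mul ((hasDerivAt_pow 2 x).neg.exp)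
    refine h.deriv.trans ?_
    simp
    ring

open MeasureTheory in
theorem integrable_iteratedDeriv_exp_neg_sq_mul_exp (n : ℕ) (b : ℝ) :
    Integrable fun x : ℝ =>
      iteratedDeriv n (fun y : ℝ => Real.exp (-y ^ 2)) x * Real.exp (-(b * x)) := by
  obtain ⟨p, hp⟩ := exists_iteratedDeriv_exp_neg_sq_eq n
  simpa only [hp] using p.integrable_eval_mul_exp_neg_sq_mul_exp b

/-- Repeated integration by parts against `e^{-bx}`. -/
theorem integral_iteratedDeriv_exp_neg_sq_mul_exp (n : ℕ) (b : ℝ) :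
    ∫ x : ℝ, iteratedDeriv n (fun y : ℝ => Real.exp (-y ^ 2)) x * Real.exp (-(b * x)) =
      b ^ n * (Real.sqrt Real.pi * Real.exp (b ^ 2 / 4)) := by
  induction n with
  | zero => simpa using integral_exp_neg_sq_mul_exp_neg_mul b
  | succ n ih =>
    have hn := integrable_iteratedDeriv_exp_neg_sq_mul_exp n b
    have hsucc := integrable_iteratedDeriv_exp_neg_sq_mul_exp (n + 1) b
    have key := MeasureTheory.integral_eq_zero_of_hasDerivAt_of_integrable
      (fun x => ?_) (hsucc.sub (hn.const_mul b)) hn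
    · rw [MeasureTheory.integral_sub' hsucc (hn.const_mul b),
        MeasureTheory.integral_const_mul, ih, sub_eq_zero] at key
      rw [key]
      ring
    · have hd : HasDerivAt (iteratedDeriv n fun y : ℝ => Real.exp (-y ^ 2))
          (iteratedDeriv (n + 1) (fun y : ℝ => Real.exp (-y ^ 2)) x) x := by
        rw [iteratedDeriv_succ]
        exact ((contDiff_exp_neg_sq (n + 1)).differentiable_iteratedDeriv n
          (by exact_mod_cast n.lt_succ_self) x).hasDerivAt
      convert! hd.mul ((hasDerivAt_id x).const_mul b).neg.exp using 1
      simp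
      ring

theorem stmt18 (n : ℕ) (α : ℝ) :
    ∫ x : ℝ, physHermite n x * Real.exp (-x ^ 2 - Real.sqrt 2 * α * x) =
      Real.sqrt Real.pi * Real.exp (α ^ 2 / 2) * (-(Real.sqrt 2 * α)) ^ n := by
  have h (x : ℝ) : physHermite n x * Real.exp (-x ^ 2 - Real.sqrt 2 * α * x) =
      (-1) ^ n * (iteratedDeriv n (fun y : ℝ => Real.exp (-y ^ 2)) x *
        Real.exp (-(Real.sqrt 2 * α * x))) := by
    have hx : Real.exp (x ^ 2) * Real.exp (-x ^ 2) = 1 := by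
      rw [← Real.exp_add, add_neg_cancel, Real.exp_zero]
    rw [physHermite, sub_eq_add_neg, Real.exp_add]
    linear_combination (-1) ^ n * iteratedDeriv n (fun y : ℝ => Real.exp (-y ^ 2)) x *
      Real.exp (-(Real.sqrt 2 * α * x)) * hx
  have hα : (Real.sqrt 2 * α) ^ 2 / 4 = α ^ 2 / 2 := by
    rw [mul_pow, Real.sq_sqrt zero_le_two]
    ring
  simp_rw [h]
  rw [MeasureTheory.integral_const_mul, integral_iteratedDeriv_exp_neg_sq_mul_exp, hα,
    neg_pow (Real.sqrt 2 * α)]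
  ring
end

section
/- Let α be a real number, n a natural number, and define u_n : ℝ → ℝ by u_n(x) = H_n(x) e^{−x²/2 − √2 α x}, where H_n is the n-th physicist Hermite polynomial. Then u_n is twice differentiable and satisfies, for every x ∈ ℝ, the eigenvalue equation −(1/2) u_n''(x) + (1/2) x² u_n(x) − √2 α u_n'(x) = (n + 1/2 + α²) u_n(x). -/
open Filter Topology

theorem hasDerivAt_iteratedDeriv_gaussian (n : ℕ) (x : ℝ) :
    HasDerivAt (iteratedDeriv n fun y : ℝ => Real.exp (-y ^ 2))
      (iteratedDeriv (n + 1) (fun y : ℝ => Real.exp (-y ^ 2)) x) x := by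
  have hsmooth : ContDiff ℝ (n + 1 : ℕ) fun y : ℝ => Real.exp (-y ^ 2) := by fun_prop
  rw [iteratedDeriv_succ]
  exact (hsmooth.differentiable_iteratedDeriv n (by exact_mod_cast n.lt_succ_self) x).hasDerivAt

theorem iteratedDeriv_one_gaussian (x : ℝ) :
    iteratedDeriv 1 (fun y : ℝ => Real.exp (-y ^ 2)) x = -2 * x * Real.exp (-x ^ 2) := by
  rw [iteratedDeriv_one]
  have h : HasDerivAt (fun y : ℝ => Real.exp (-y ^ 2)) _ x := (hasDerivAt_pow 2 x).neg.exp
  rw [h.deriv]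
  simp
  ring

theorem iteratedDeriv_gaussian_add_two (n : ℕ) (x : ℝ) :
    iteratedDeriv (n + 2) (fun y : ℝ => Real.exp (-y ^ 2)) x =
      -2 * x * iteratedDeriv (n + 1) (fun y : ℝ => Real.exp (-y ^ 2)) x -
        2 * (n + 1) * iteratedDeriv n (fun y : ℝ => Real.exp (-y ^ 2)) x := by
  induction n generalizing x with
  | zero =>
    have h := ((hasDerivAt_id x).const_mul (-2)).mul (hasDerivAt_iteratedDeriv_gaussian 0 x)
    have h1 := hasDerivAt_iteratedDeriv_gaussian 1 x
    rw [show iteratedDeriv 1 (fun y : ℝ => Real.exp (-y ^ 2)) = _ from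
      funext iteratedDeriv_one_gaussian] at h1
    have := h1.unique (h.congr_of_eventuallyEq (.of_forall fun y => by simp))
    simp only [Nat.reduceAdd, zero_add, id_eq] at this ⊢
    rw [this]
    push_cast
    ring
  | succ k ih =>
    have h := (((hasDerivAt_id x).const_mul (-2)).mul
      (hasDerivAt_iteratedDeriv_gaussian (k + 1) x)).sub
      ((hasDerivAt_iteratedDeriv_gaussian k x).const_mul (2 * ((k : ℝ) + 1)))
    have := (hasDerivAt_iteratedDeriv_gaussian (k + 2) x).unique
      (h.congr_of_eventuallyEq (.of_forall fun y => by simp [ih y]))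
    simp only [id_eq] at this
    rw [show k + 1 + 2 = k + 2 + 1 from rfl, this]
    push_cast
    ring

theorem stmt19 (n : ℕ) (α : ℝ) (u : ℝ → ℝ)
    (hu : ∀ x : ℝ, u x = physHermite n x * Real.exp (-x ^ 2 / 2 - Real.sqrt 2 * α * x)) :
    (∀ x : ℝ, DifferentiableAt ℝ u x) ∧
    (∀ x : ℝ, DifferentiableAt ℝ (deriv u) x) ∧
    ∀ x : ℝ,
      -(1 / 2) * deriv (deriv u) x + (1 / 2) * x ^ 2 * u x -
          Real.sqrt 2 * α * deriv u x =
        ((n : ℝ) + 1 / 2 + α ^ 2) * u x := by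
  set g : ℕ → ℝ → ℝ := fun k => iteratedDeriv k fun y : ℝ => Real.exp (-y ^ 2) with hg
  set s := Real.sqrt 2 * α with hs
  have hs2 : s ^ 2 = 2 * α ^ 2 := by
    rw [hs, mul_pow, Real.sq_sqrt (by norm_num)]
  set E : ℝ → ℝ := fun x => (-1) ^ n * Real.exp (x ^ 2 / 2 - s * x) with hE
  have hgd (k : ℕ) (x : ℝ) : HasDerivAt (g k) (g (k + 1) x) x :=
    hasDerivAt_iteratedDeriv_gaussian k x
  have hrec (x : ℝ) : g (n + 2) x = -2 * x * g (n + 1) x - 2 * (n + 1) * g n x :=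
    iteratedDeriv_gaussian_add_two n x
  have hEd (x : ℝ) : HasDerivAt E ((x - s) * E x) x := by
    have h := ((((hasDerivAt_pow 2 x).div_const 2).sub
      ((hasDerivAt_id x).const_mul s)).exp).const_mul ((-1 : ℝ) ^ n)
    refine h.congr_deriv ?_
    simp [hE]
    ring
  have hu' : u = fun x => E x * g n x := by
    funext x
    have hexp : Real.exp (x ^ 2 / 2 - s * x) =
        Real.exp (x ^ 2) * Real.exp (-x ^ 2 / 2 - s * x) := by
      rw [← Real.exp_add]
      ring_nf
    rw [hu, physHermite, hE]
    simp only [hexp, hg]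
    ring
  have hud (x : ℝ) : HasDerivAt u (E x * ((x - s) * g n x + g (n + 1) x)) x := by
    rw [hu']
    exact ((hEd x).mul (hgd n x)).congr_deriv (by ring)
  have hdu : deriv u = fun x => E x * ((x - s) * g n x + g (n + 1) x) :=
    funext fun x => (hud x).deriv
  have hudd (x : ℝ) : HasDerivAt (deriv u)
      (E x * (((x - s) ^ 2 + 1) * g n x + 2 * (x - s) * g (n + 1) x + g (n + 2) x)) x := by
    rw [hdu]
    exact ((hEd x).mul ((((hasDerivAt_id x).sub_const s).mul (hgd n x)).add
      (hgd (n + 1) x))).congr_deriv (by simp; ring)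
  refine ⟨fun x => (hud x).differentiableAt, fun x => (hudd x).differentiableAt, fun x => ?_⟩
  rw [(hudd x).deriv, (hud x).deriv, hrec, hu']
  linear_combination (1 / 2) * E x * g n x * hs2
end
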